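/- For all 1 ≤ i < j ≤ n and i ≤ k ≤ j one has in 𝒟_n: E_{i,j}E_k = q^{−1}E_kE_{i,j} if k = j; E_{i,j}E_k = qE_kE_{i,j} if k = i; and E_{i,j}E_k = E_kE_{i,j} if i < k < j. -/

import Mathlib

noncomputable section

/-- The ground field `𝕂 = ℂ(q)`, the field of rational functions over `ℂ`. -/
abbrev Kq : Type := RatFunc ℂ

/-- The formal variable `q ∈ ℂ(q)`. -/
def qq : Kq := RatFunc.X

/-- `𝐢 = √−1 ∈ ℂ`, viewed as a constant in `𝕂 = ℂ(q)`. -/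
def ii : Kq := RatFunc.C Complex.I

/-- `θ(i) = n + 1 − i`. -/
def th (n : ℕ) (i : ℤ) : ℤ := (n : ℤ) + 1 - i

/-- Labels for the vertices of the `𝒟ₙ`-quiver: `V i r` stands for `V_{i,r}`
(the canonical labels), and `C i` stands for the central vertex `Λ_{i,0}`. -/
inductive DnLabel : Type
  | V : ℤ → ℤ → DnLabel
  | C : ℤ → DnLabel
deriving DecidableEq

/-- Validity of a label for given rank `n`: `V i r` requires `1 ≤ i ≤ n`, `−i ≤ r ≤ i`;
`C i` requires `1 ≤ i ≤ n`.  There are `n² + 3n` valid labels. -/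
def DnLabel.valid (n : ℕ) : DnLabel → Prop
  | .V i r => 1 ≤ i ∧ i ≤ (n : ℤ) ∧ -i ≤ r ∧ r ≤ i
  | .C i => 1 ≤ i ∧ i ≤ (n : ℤ)

instance (n : ℕ) (v : DnLabel) : Decidable (v.valid n) := by
  cases v <;> unfold DnLabel.valid <;> infer_instance

/-- The vertex set of the `𝒟ₙ`-quiver. -/
def DnVertex (n : ℕ) := {v : DnLabel // v.valid n}

/-- The canonical label of the vertex `Λ_{i,r}`, using the identifications
`Λ_{a,b} = V_{θ(b),−θ(a)}` for `b > 0` and `Λ_{a,b} = V_{θ(−b),θ(a)}` for `b < 0`. -/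
def Lam (n : ℕ) (i r : ℤ) : DnLabel :=
  if 0 < r then .V (th n r) (-(th n i))
  else if r < 0 then .V (th n (-r)) (th n i)
  else .C i

/-- The list of arrows `(source, target, doubled weight)` of the `𝒟ₙ`-quiver, obtained by
amalgamating two copies of the Fock–Goncharov `(n+1)`-triangle quiver along two pairs of
sides.  Solid (weight `1`) arrows get doubled weight `2`, dashed (weight `1/2`) arrows get
doubled weight `1`.  The families are: the horizontal `V_i`- and `Λ_i`-path arrows, the
dashed boundary arrows along the two frozen columns, and, for each `1 ≤ i < n`, the
oriented cycle `V_{i,0} → V_{i+1,−1} → ⋯ → V_{n,i−n} → Λ_{i,0} → V_{n,n−i} → ⋯ → V_{i+1,1} → V_{i,0}`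
through the central column. -/
def dnArrows (n : ℕ) : List (DnLabel × DnLabel × ℤ) :=
  ((List.range n).flatMap fun i0 =>
    (List.range (2 * i0 + 2)).map fun k =>
      (DnLabel.V ((i0 : ℤ) + 1) (-((i0 : ℤ) + 1) + k),
       DnLabel.V ((i0 : ℤ) + 1) (-((i0 : ℤ) + 1) + k + 1), 2))
  ++ ((List.range n).flatMap fun i0 =>
    (List.range (2 * i0 + 2)).map fun k =>
      (Lam n ((i0 : ℤ) + 1) (-((i0 : ℤ) + 1) + k),
       Lam n ((i0 : ℤ) + 1) (-((i0 : ℤ) + 1) + k + 1), 2))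
  ++ ((List.range (n - 1)).map fun i0 =>
      (DnLabel.V ((i0 : ℤ) + 1) (-((i0 : ℤ) + 1)),
       DnLabel.V ((i0 : ℤ) + 2) (-((i0 : ℤ) + 2)), 1))
  ++ ((List.range (n - 1)).map fun i0 =>
      (DnLabel.V ((i0 : ℤ) + 2) ((i0 : ℤ) + 2),
       DnLabel.V ((i0 : ℤ) + 1) ((i0 : ℤ) + 1), 1))
  ++ ((List.range (n - 1)).flatMap fun i0 =>
      (((List.range (n - 1 - i0)).map fun k =>
          (DnLabel.V ((i0 : ℤ) + 1 + k) (-(k : ℤ)),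
           DnLabel.V ((i0 : ℤ) + 2 + k) (-(k : ℤ) - 1), 2))
        ++ [(DnLabel.V (n : ℤ) ((i0 : ℤ) + 1 - n), DnLabel.C ((i0 : ℤ) + 1), 2),
            (DnLabel.C ((i0 : ℤ) + 1), DnLabel.V (n : ℤ) ((n : ℤ) - (i0 + 1)), 2)]
        ++ ((List.range (n - 1 - i0)).map fun k =>
          (DnLabel.V ((i0 : ℤ) + 2 + k) ((k : ℤ) + 1),
           DnLabel.V ((i0 : ℤ) + 1 + k) (k : ℤ), 2))))

/-- The doubled exchange matrix `2·ε_{uv}` of the `𝒟ₙ`-quiver. -/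
def eps2 (n : ℕ) (u v : DnLabel) : ℤ :=
  ((dnArrows n).map fun a =>
    (if a.1 = u ∧ a.2.1 = v then a.2.2 else 0)
      - (if a.1 = v ∧ a.2.1 = u then a.2.2 else 0)).sum

/-- The defining relations of the quantum torus algebra `𝒟ₙ`: generators `X_v^{±1}`
(`Sum.inl v` is `X_v`, `Sum.inr v` is `X_v⁻¹`) with `X_u X_v = q^{2 ε_{vu}} X_v X_u`. -/
inductive DnRel (n : ℕ) :
    FreeAlgebra Kq (DnVertex n ⊕ DnVertex n) →
      FreeAlgebra Kq (DnVertex n ⊕ DnVertex n) → Prop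
  | comm (u v : DnVertex n) :
      DnRel n (FreeAlgebra.ι Kq (Sum.inl u) * FreeAlgebra.ι Kq (Sum.inl v))
        ((qq ^ eps2 n v.1 u.1) • (FreeAlgebra.ι Kq (Sum.inl v) * FreeAlgebra.ι Kq (Sum.inl u)))
  | mul_inv (v : DnVertex n) :
      DnRel n (FreeAlgebra.ι Kq (Sum.inl v) * FreeAlgebra.ι Kq (Sum.inr v)) 1
  | inv_mul (v : DnVertex n) :
      DnRel n (FreeAlgebra.ι Kq (Sum.inr v) * FreeAlgebra.ι Kq (Sum.inl v)) 1

/-- The quantum torus algebra `𝒟ₙ`. -/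
abbrev Dtorus (n : ℕ) := RingQuot (DnRel n)

/-- The cluster variable `X_v ∈ 𝒟ₙ` attached to a label (junk value `1` on invalid labels). -/
def Xg (n : ℕ) (v : DnLabel) : Dtorus n :=
  if h : v.valid n then RingQuot.mkAlgHom Kq (DnRel n) (FreeAlgebra.ι Kq (Sum.inl ⟨v, h⟩)) else 1

/-- The inverse cluster variable `X_v⁻¹ ∈ 𝒟ₙ` (junk value `1` on invalid labels). -/
def Xinv (n : ℕ) (v : DnLabel) : Dtorus n :=
  if h : v.valid n then RingQuot.mkAlgHom Kq (DnRel n) (FreeAlgebra.ι Kq (Sum.inr ⟨v, h⟩)) else 1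

/-- The ordered product `X_{V_{i,−i}} X_{V_{i,1−i}} ⋯ X_{V_{i,r}}`. -/
def Vprod (n : ℕ) (i r : ℤ) : Dtorus n :=
  ((List.range (r + i + 1).toNat).map fun k => Xg n (.V i (-i + k))).prod

/-- The ordered product `X_{Λ_{i,−i}} X_{Λ_{i,1−i}} ⋯ X_{Λ_{i,r}}`. -/
def Lprod (n : ℕ) (i r : ℤ) : Dtorus n :=
  ((List.range (r + i + 1).toNat).map fun k => Xg n (Lam n i (-i + k))).prod

/-- `w_i^r = 𝐢 q^{i+r} X_{V_{i,−i}} X_{V_{i,1−i}} ⋯ X_{V_{i,r}}`. -/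
def ww (n : ℕ) (i r : ℤ) : Dtorus n := (ii * qq ^ (i + r)) • Vprod n i r

/-- `m_i^r = 𝐢 q^{i+r} X_{Λ_{i,−i}} X_{Λ_{i,1−i}} ⋯ X_{Λ_{i,r}}`. -/
def mm (n : ℕ) (i r : ℤ) : Dtorus n := (ii * qq ^ (i + r)) • Lprod n i r


/-- `E_i = Σ_{r=−i}^{i−1} w_i^r ∈ 𝒟ₙ`, the image of the Chevalley generator `E_i`. -/
def Ev (n : ℕ) (i : ℤ) : Dtorus n := ∑ r ∈ Finset.Icc (-i) (i - 1), ww n i r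

/-- `F_j = Σ_{r=−θ(j)}^{θ(j)−1} m_{θ(j)}^r ∈ 𝒟ₙ`, the image of the Chevalley generator `F_j`. -/
def Fv (n : ℕ) (j : ℤ) : Dtorus n :=
  ∑ r ∈ Finset.Icc (-(th n j)) (th n j - 1), mm n (th n j) r

/-- Auxiliary recursion: `EEaux n i k = E_{i,i+k}`. -/
def EEaux (n : ℕ) (i : ℤ) : ℕ → Dtorus n
  | 0 => Ev n i
  | k + 1 => (qq - qq⁻¹)⁻¹ •
      (EEaux n i k * Ev n (i + k + 1) - qq • (Ev n (i + k + 1) * EEaux n i k))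

/-- The quantum root vector `E_{i,j}`, defined by `E_{i,i} = E_i` and
`E_{i,j} = (E_{i,j−1}E_j − qE_jE_{i,j−1})/(q−q^{−1})`. -/
def EE (n : ℕ) (i j : ℤ) : Dtorus n := EEaux n i (j - i).toNat

/-- Auxiliary recursion: `FFaux n i k = F_{i,i+k}`. -/
def FFaux (n : ℕ) (i : ℤ) : ℕ → Dtorus n
  | 0 => Fv n i
  | k + 1 => (qq - qq⁻¹)⁻¹ •
      (Fv n (i + k + 1) * FFaux n i k - qq⁻¹ • (FFaux n i k * Fv n (i + k + 1)))

/-- The quantum root vector `F_{i,j}`, defined by `F_{i,i} = F_i` and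
`F_{i,j} = (F_jF_{i,j−1} − q^{−1}F_{i,j−1}F_j)/(q−q^{−1})`. -/
def FF (n : ℕ) (i j : ℤ) : Dtorus n := FFaux n i (j - i).toNat

/-- The doubled total weight of the arrows from `u` to `v` in the `𝒟ₙ`-quiver. -/
def arrowWeight (n : ℕ) (u v : DnLabel) : ℤ :=
  ((dnArrows n).map fun a => if a.1 = u ∧ a.2.1 = v then a.2.2 else 0).sum

lemma eps2_eq_arrowWeight_sub (n : ℕ) (u v : DnLabel) :
    eps2 n u v = arrowWeight n u v - arrowWeight n v u := by
  unfold eps2 arrowWeight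
  induction dnArrows n with
  | nil => simp
  | cons a l ih => simp only [List.map_cons, List.sum_cons, ih]; ring

lemma sum_map_range_ite (m : ℕ) (P : ℕ → Prop) [DecidablePred P] (Q : Prop) [Decidable Q] (c : ℤ)
    (huniq : ∀ k l, P k → P l → k = l) (hQ : (∃ k < m, P k) ↔ Q) :
    ((List.range m).map fun k => if P k then c else 0).sum = if Q then c else 0 := by
  classical
  have hsum : ((List.range m).map fun k => if P k then c else 0).sum
      = ∑ k ∈ Finset.range m, if P k then c else 0 := rfl
  rw [hsum]
  split_ifs with h
  · obtain ⟨l, hl, hPl⟩ := hQ.2 h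
    rw [Finset.sum_eq_single l (fun k _ hk => if_neg fun hPk => hk (huniq k l hPk hPl))
      (fun h => absurd (Finset.mem_range.2 hl) h), if_pos hPl]
  · exact Finset.sum_eq_zero fun k hk =>
      if_neg fun hPk => h (hQ.1 ⟨k, Finset.mem_range.1 hk, hPk⟩)

lemma sum_map_range_range_ite (n : ℕ) (m : ℕ → ℕ) (P : ℕ → ℕ → Prop)
    [∀ i k, Decidable (P i k)] (Q : Prop) [Decidable Q] (c : ℤ)
    (huniq : ∀ i k j l, P i k → P j l → i = j ∧ k = l)
    (hQ : (∃ i < n, ∃ k < m i, P i k) ↔ Q) :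
    ((List.range n).map fun i =>
      ((List.range (m i)).map fun k => if P i k then c else 0).sum).sum
      = if Q then c else 0 := by
  classical
  have h : ∀ i, ((List.range (m i)).map fun k => if P i k then c else 0).sum
      = if ∃ k < m i, P i k then c else 0 := fun i =>
    sum_map_range_ite (m i) (P i) _ c (fun k l hk hl => (huniq i k i l hk hl).2) Iff.rfl
  simp only [h]
  refine sum_map_range_ite n (fun i => ∃ k < m i, P i k) Q c ?_ hQ
  rintro i j ⟨k, -, hk⟩ ⟨l, -, hl⟩
  exact (huniq i k j l hk hl).1

lemma sum_flatMap_int {α : Type*} (l : List α) (f : α → List ℤ) :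
    (l.flatMap f).sum = (l.map fun a => (f a).sum).sum := by
  induction l with
  | nil => rfl
  | cons a l ih => simp [ih]

lemma lam_eq_V_iff (n : ℕ) (i r a s : ℤ) :
    Lam n i r = .V a s ↔
      (0 < r ∧ a = n + 1 - r ∧ s = i - n - 1) ∨ (r < 0 ∧ a = n + 1 + r ∧ s = n + 1 - i) := by
  unfold Lam th
  split_ifs <;> simp only [DnLabel.V.injEq, false_iff] <;> omega

lemma arrowWeight_V_V (n : ℕ) (a r b s : ℤ) (hu : (DnLabel.V a r).valid n)
    (hv : (DnLabel.V b s).valid n) :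
    arrowWeight n (.V a r) (.V b s) =
      (if a = b ∧ s = r + 1 then 2 else 0)
      + (if s = r ∧ ((b = a - 1 ∧ r < 0) ∨ (b = a + 1 ∧ 0 < r)) then 2 else 0)
      + (if b = a + 1 ∧ r = -a ∧ s = -b then 1 else 0)
      + (if a = b + 1 ∧ r = a ∧ s = b then 1 else 0)
      + (if b = a + 1 ∧ r ≤ 0 ∧ -a < r ∧ s = r - 1 then 2 else 0)
      + (if a = b + 1 ∧ 0 ≤ s ∧ s < b ∧ r = s + 1 then 2 else 0) := by
  classical
  obtain ⟨ha1, han, hra, har⟩ := hu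
  obtain ⟨hb1, hbn, hsb, hbs⟩ := hv
  unfold arrowWeight dnArrows
  simp only [List.map_append, List.sum_append, List.map_flatMap, sum_flatMap_int, List.bind_eq_flatMap, List.pure_def,
    ← List.map_eq_flatMap, List.map_map,
    Function.comp_def, List.map_cons, List.map_nil, List.sum_cons, List.sum_nil, reduceCtorEq,
    and_false, false_and, if_false, add_zero, List.sum_map_add, DnLabel.V.injEq]
  rw [sum_map_range_range_ite n _ _ (a = b ∧ s = r + 1) 2,
    sum_map_range_range_ite n _ _ (s = r ∧ ((b = a - 1 ∧ r < 0) ∨ (b = a + 1 ∧ 0 < r))) 2,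
    sum_map_range_ite (n - 1) _ (b = a + 1 ∧ r = -a ∧ s = -b) 1,
    sum_map_range_ite (n - 1) _ (a = b + 1 ∧ r = a ∧ s = b) 1,
    sum_map_range_range_ite (n - 1) _ _ (b = a + 1 ∧ r ≤ 0 ∧ -a < r ∧ s = r - 1) 2,
    sum_map_range_range_ite (n - 1) _ _ (a = b + 1 ∧ 0 ≤ s ∧ s < b ∧ r = s + 1) 2]
  · ring
  · intros; omega
  · exact ⟨by rintro ⟨i, hi, k, hk⟩; omega,
      fun h => ⟨(b - 1 - s).toNat, by omega, s.toNat, by omega⟩⟩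
  · intros; omega
  · exact ⟨by rintro ⟨i, hi, k, hk⟩; omega,
      fun h => ⟨(a - 1 + r).toNat, by omega, (-r).toNat, by omega⟩⟩
  · intros; omega
  · exact ⟨by rintro ⟨k, hk⟩; omega, fun h => ⟨(b - 1).toNat, by omega⟩⟩
  · intros; omega
  · exact ⟨by rintro ⟨k, hk⟩; omega, fun h => ⟨(a - 1).toNat, by omega⟩⟩
  · simp only [lam_eq_V_iff]; intros; omega
  · simp only [lam_eq_V_iff]
    constructor
    · rintro ⟨i, hi, k, hk⟩; omega
    · rintro ⟨h, h' | h'⟩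
      · exact ⟨(n + r).toNat, by omega, (2 * n + 2 + r - a).toNat, by omega⟩
      · exact ⟨(n - r).toNat, by omega, (a - r).toNat, by omega⟩
  · intros; omega
  · exact ⟨by rintro ⟨i, hi, k, hk⟩; omega,
      fun h => ⟨(a - 1).toNat, by omega, (r + a).toNat, by omega⟩⟩

/-- `x` and `y` commute up to the factor `q ^ e`. -/
def QComm {K R : Type*} [Field K] [Ring R] [Algebra K R] (q : K) (e : ℤ) (x y : R) : Prop :=
  x * y = q ^ e • (y * x)

namespace QComm

variable {K R : Type*} [Field K] [Ring R] [Algebra K R] {q : K} {e f : ℤ} {x y z : R}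

lemma one_right : QComm q 0 x 1 := by simp [QComm]

lemma one_left : QComm q 0 1 x := by simp [QComm]

lemma congr (h : QComm q e x y) (hef : e = f) : QComm q f x y := hef ▸ h

lemma of_commute (h : Commute x y) : QComm q 0 x y := by
  simpa [QComm, Commute, SemiconjBy] using h

lemma self : QComm q 0 x x := by simp [QComm]

lemma symm (hq : q ≠ 0) (h : QComm q e x y) : QComm q (-e) y x := by
  unfold QComm at *
  rw [h, smul_smul, ← zpow_add₀ hq, neg_add_cancel, zpow_zero, one_smul]

lemma mul_right (hq : q ≠ 0) (hy : QComm q e x y) (hz : QComm q f x z) :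
    QComm q (e + f) x (y * z) := by
  unfold QComm at *
  rw [← mul_assoc, hy, smul_mul_assoc, mul_assoc, hz, mul_smul_comm, smul_smul, zpow_add₀ hq,
    mul_assoc]

lemma mul_left (hq : q ≠ 0) (hx : QComm q e x z) (hy : QComm q f y z) :
    QComm q (e + f) (x * y) z := by
  unfold QComm at *
  rw [mul_assoc, hy, mul_smul_comm, ← mul_assoc, hx, smul_mul_assoc, smul_smul, zpow_add₀ hq,
    mul_assoc, mul_comm (q ^ f)]

lemma smul_left (c : K) (h : QComm q e x y) : QComm q e (c • x) y := by
  unfold QComm at *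
  rw [smul_mul_assoc, h, mul_smul_comm, smul_comm]

lemma smul_right (c : K) (h : QComm q e x y) : QComm q e x (c • y) := by
  unfold QComm at *
  rw [mul_smul_comm, h, smul_mul_assoc, smul_comm]

lemma sum_left {ι : Type*} {S : Finset ι} {g : ι → R} (h : ∀ r ∈ S, QComm q e (g r) y) :
    QComm q e (∑ r ∈ S, g r) y := by
  unfold QComm at *
  rw [Finset.sum_mul, Finset.mul_sum, Finset.smul_sum]
  exact Finset.sum_congr rfl h

lemma sum_right {ι : Type*} {S : Finset ι} {g : ι → R} (h : ∀ r ∈ S, QComm q e x (g r)) :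
    QComm q e x (∑ r ∈ S, g r) := by
  unfold QComm at *
  rw [Finset.sum_mul, Finset.mul_sum, Finset.smul_sum]
  exact Finset.sum_congr rfl h

lemma commute (h : QComm q 0 x y) : Commute x y := by
  simpa [QComm, Commute, SemiconjBy] using h

end QComm

/-- The quantum Serre relation, quadratic in `x` and linear in `y`. -/
def QSerre {K R : Type*} [Field K] [Ring R] [Algebra K R] (q : K) (x y : R) : Prop :=
  x * (x * y) - (q + q⁻¹) • (x * (y * x)) + y * (x * x) = 0

section Serre

variable {K R : Type*} [Field K] [Ring R] [Algebra K R] {q : K}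

lemma QSerre.of_qComm (hq : q ≠ 0) {a b y : R} (ha : QComm q 1 a y) (hb : QComm q (-1) b y)
    (hab : QComm q (-2) a b) : QSerre q (a + b) y := by
  unfold QSerre QComm at *
  rw [zpow_one] at ha
  rw [zpow_neg_one] at hb
  have ha' (z : R) : a * (y * z) = q • (y * (a * z)) := by
    rw [← mul_assoc, ha, smul_mul_assoc, mul_assoc]
  have hb' (z : R) : b * (y * z) = q⁻¹ • (y * (b * z)) := by
    rw [← mul_assoc, hb, smul_mul_assoc, mul_assoc]
  have hq2 : q ^ (-2 : ℤ) = (q ^ 2)⁻¹ := by rw [zpow_neg]; norm_cast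
  rw [hq2] at hab
  simp only [mul_add, add_mul, ha, hb, ha', hb', hab, mul_smul_comm, smul_add, smul_smul]
  match_scalars <;> field_simp <;> ring

lemma QSerre.sum_right {ι : Type*} {S : Finset ι} {x : R} {g : ι → R}
    (h : ∀ s ∈ S, QSerre q x (g s)) : QSerre q x (∑ s ∈ S, g s) := by
  unfold QSerre at *
  simp only [Finset.sum_mul, Finset.mul_sum, Finset.smul_sum, ← Finset.sum_sub_distrib,
    ← Finset.sum_add_distrib]
  exact Finset.sum_eq_zero h

lemma QSerre.sum_left_of_initial (hq : q ≠ 0) (S : Finset ℤ) (x : ℤ → R) (y : R) (p : ℤ → Prop)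
    (hp : ∀ r ∈ S, ∀ t ∈ S, r < t → p t → p r)
    (hx : ∀ r ∈ S, ∀ t ∈ S, r < t → QComm q (-2) (x r) (x t))
    (hy : ∀ r ∈ S, p r → QComm q 1 (x r) y) (hy' : ∀ r ∈ S, ¬ p r → QComm q (-1) (x r) y) :
    QSerre q (∑ r ∈ S, x r) y := by
  classical
  rw [← Finset.sum_filter_add_sum_filter_not S p]
  refine .of_qComm hq (.sum_left fun r hr => ?_) (.sum_left fun r hr => ?_)
    (.sum_left fun r hr => .sum_right fun t ht => ?_)
  · rw [Finset.mem_filter] at hr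
    exact hy r hr.1 hr.2
  · rw [Finset.mem_filter] at hr
    exact hy' r hr.1 hr.2
  · rw [Finset.mem_filter] at hr ht
    refine hx r hr.1 t ht.1 (lt_of_not_ge fun h => ?_)
    rcases h.eq_or_lt with h | h
    · exact ht.2 (h ▸ hr.2)
    · exact ht.2 (hp t ht.1 r hr.1 h hr.2)

/-- The `q`-commutator `[x, y]_q` normalised by a scalar `c`. -/
def qBracket (q c : K) (x y : R) : R := c • (x * y - q • (y * x))

lemma QSerre.qBracket_of_commute {a b x : R} (c : K) (hax : Commute a x) (h : QSerre q x b) :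
    QSerre q x (qBracket q c a b) := by
  have hxa : x * a = a * x := hax.eq.symm
  have hxa' (z : R) : x * (a * z) = a * (x * z) := by rw [← mul_assoc, hxa, mul_assoc]
  unfold QSerre qBracket at *
  have h1 := congrArg (fun z => c • (a * z)) h
  have h2 := congrArg (fun z => (c * q) • (z * a)) h
  simp only [mul_add, add_mul, mul_sub, sub_mul, smul_mul_assoc, mul_smul_comm, smul_sub,
    smul_add, smul_smul, mul_assoc, hxa, hxa', mul_zero, zero_mul, smul_zero] at h1 h2 ⊢
  rw [← sub_eq_zero.2 (h1.trans h2.symm)]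
  module

lemma qComm_qBracket_right_of_qSerre (hq : q ≠ 0) {a b : R} (c : K) (h : QSerre q b a) :
    QComm q (-1) (qBracket q c a b) b := by
  unfold QSerre QComm qBracket at *
  have h1 := congrArg (fun z => c • z) h
  rw [zpow_neg_one]
  simp only [mul_add, mul_sub, sub_mul, smul_mul_assoc, mul_smul_comm, smul_sub,
    smul_add, smul_smul, mul_assoc, smul_zero] at h1 ⊢
  rw [← sub_eq_zero, ← h1]
  match_scalars <;> field_simp; ring

lemma qComm_qBracket_left_of_qSerre (hq : q ≠ 0) {a b : R} (c : K) (h : QSerre q a b) :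
    QComm q 1 (qBracket q c a b) a := by
  unfold QSerre QComm qBracket at *
  have h1 := congrArg (fun z => (-(q * c)) • z) h
  rw [zpow_one]
  simp only [mul_add, mul_sub, sub_mul, smul_mul_assoc, mul_smul_comm, smul_sub,
    smul_add, smul_smul, mul_assoc, smul_zero] at h1 ⊢
  rw [← sub_eq_zero, ← h1]
  match_scalars <;> field_simp; ring

lemma QComm.qBracket_of_commute {a b x : R} {e : ℤ} (c : K) (ha : QComm q e a x)
    (hb : Commute b x) : QComm q e (qBracket q c a b) x := by
  have hb' : x * b = b * x := hb.eq.symm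
  have hb'' (z : R) : x * (b * z) = b * (x * z) := by rw [← mul_assoc, hb', mul_assoc]
  unfold QComm qBracket at *
  have ha' (z : R) : a * (x * z) = q ^ e • (x * (a * z)) := by
    rw [← mul_assoc, ha, smul_mul_assoc, mul_assoc]
  rw [smul_mul_assoc, mul_smul_comm, smul_comm _ c]
  congr 1
  simp only [sub_mul, mul_sub, smul_mul_assoc, mul_smul_comm, mul_assoc, ← hb', ha', ha, smul_sub,
    smul_smul]
  simp only [hb'', mul_comm q]

lemma commute_qBracket_qBracket (hq : q ≠ 0) (hq2 : 1 + q ^ 2 ≠ 0) {a b d : R} (c c' : K)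
    (had : Commute a d) (hba : QSerre q b a) (hbd : QSerre q b d) :
    Commute (qBracket q c (qBracket q c' a b) d) b := by
  have hT : qBracket q c (qBracket q c' a b) d = (c * c') • qBracket q 1 (qBracket q 1 a b) d := by
    simp only [qBracket, one_smul, smul_mul_assoc, mul_smul_comm]
    module
  have hX := qComm_qBracket_right_of_qSerre hq 1 hba
  have hY := qComm_qBracket_left_of_qSerre hq 1 hbd
  set X := qBracket q 1 a b with hXdef
  set Y := qBracket q 1 b d with hYdef
  set T := qBracket q 1 X d with hTdef
  have hTY : T = a * Y - q • (Y * a) := by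
    have had' (z : R) : a * (d * z) = d * (a * z) := by rw [← mul_assoc, had.eq, mul_assoc]
    simp only [hTdef, hXdef, hYdef, qBracket, one_smul, mul_sub, sub_mul, smul_mul_assoc,
      mul_smul_comm, smul_sub, smul_smul, mul_assoc, had.eq, had']
    module
  have hTX : T = X * d - q • (d * X) := by rw [hTdef, qBracket, one_smul]
  have hab : a * b = X + q • (b * a) := by rw [hXdef, qBracket, one_smul]; abel
  have hdb : d * b = q⁻¹ • (b * d - Y) := by
    rw [hYdef, qBracket, one_smul, sub_sub_cancel, smul_smul, inv_mul_cancel₀ hq, one_smul]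
  rw [QComm, zpow_neg_one] at hX
  rw [QComm, zpow_one] at hY
  clear_value X Y T
  have h1 : T * b = q • (X * Y - Y * X) + q ^ 2 • (b * T) := by
    have hab' (z : R) : a * (b * z) = X * z + q • (b * (a * z)) := by
      rw [← mul_assoc, hab, add_mul, smul_mul_assoc, mul_assoc]
    have hY' (z : R) : Y * (b * z) = q • (b * (Y * z)) := by
      rw [← mul_assoc, hY, smul_mul_assoc, mul_assoc]
    simp only [hTY, mul_sub, sub_mul, mul_add, smul_mul_assoc, mul_smul_comm, smul_sub, smul_add,
      smul_smul, mul_assoc, hab, hab', hY, hY']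
    module
  have h2 : q • (T * b) = q⁻¹ • (b * T) - (X * Y - Y * X) := by
    have hX' (z : R) : X * (b * z) = q⁻¹ • (b * (X * z)) := by
      rw [← mul_assoc, hX, smul_mul_assoc, mul_assoc]
    have hdb' (z : R) : d * (b * z) = q⁻¹ • (b * (d * z) - Y * z) := by
      rw [← mul_assoc, hdb, smul_mul_assoc, sub_mul, mul_assoc]
    simp only [hTX, mul_sub, sub_mul, smul_mul_assoc, mul_smul_comm, smul_sub,
      smul_smul, mul_assoc, hdb, hdb', hX, hX']
    match_scalars <;> field_simp
  have h3 : (1 + q ^ 2) • (T * b) = (1 + q ^ 2) • (b * T) := by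
    have h4 : (1 + q ^ 2) • (T * b) = T * b + q • q • (T * b) := by module
    rw [h4, h2, h1]
    match_scalars <;> field_simp <;> ring
  rw [hT]
  exact Commute.smul_left (smul_right_injective R hq2 h3) _

end Serre

lemma qq_ne_zero : qq ≠ 0 := RatFunc.X_ne_zero

lemma one_add_qq_sq_ne_zero : 1 + qq ^ 2 ≠ 0 := by
  have h : 1 + qq ^ 2 = algebraMap (Polynomial ℂ) Kq (Polynomial.X ^ 2 + Polynomial.C 1) := by
    simp [qq, RatFunc.algebraMap_X, add_comm]
  rw [h]
  exact RatFunc.algebraMap_ne_zero (Polynomial.monic_X_pow_add_C 1 two_ne_zero).ne_zero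

section Torus

variable {n : ℕ}

lemma qComm_Xg {u v : DnLabel} (hu : u.valid n) (hv : v.valid n) :
    QComm qq (eps2 n v u) (Xg n u) (Xg n v) := by
  have h := RingQuot.mkAlgHom_rel Kq (DnRel.comm (n := n) ⟨u, hu⟩ ⟨v, hv⟩)
  simp only [map_mul, map_smul] at h
  simpa only [QComm, Xg, dif_pos hu, dif_pos hv] using h

lemma qComm_Xg_V {a r b s : ℤ} (ha : 1 ≤ a ∧ a ≤ n ∧ -a ≤ r ∧ r ≤ a)
    (hb : 1 ≤ b ∧ b ≤ n ∧ -b ≤ s ∧ s ≤ b) :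
    QComm qq (eps2 n (.V b s) (.V a r)) (Xg n (.V a r)) (Xg n (.V b s)) :=
  qComm_Xg ha hb

lemma Vprod_neg_sub_one (n : ℕ) (i : ℤ) : Vprod n i (-i - 1) = 1 := by
  have h : (-i - 1 + i + 1).toNat = 0 := by omega
  simp [Vprod, h]

lemma Vprod_add_one (n : ℕ) {i r : ℤ} (hr : -i - 1 ≤ r) :
    Vprod n i (r + 1) = Vprod n i r * Xg n (.V i (r + 1)) := by
  obtain ⟨m, hm⟩ := Int.eq_ofNat_of_zero_le (show 0 ≤ r + i + 1 by omega)
  have h1 : (r + 1 + i + 1).toNat = m + 1 := by omega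
  have h2 : (r + i + 1).toNat = m := by omega
  have h3 : -i + (m : ℤ) = r + 1 := by omega
  unfold Vprod
  rw [h1, h2, List.range_succ]
  simp [h3]

lemma arrowWeight_V_same {i r s : ℤ} (hu : (DnLabel.V i r).valid n)
    (hv : (DnLabel.V i s).valid n) :
    arrowWeight n (.V i r) (.V i s) = if s = r + 1 then 2 else 0 := by
  rw [arrowWeight_V_V _ _ _ _ _ hu hv]
  have h1 : i ≠ i - 1 := by omega
  simp [h1]

lemma arrowWeight_V_far {a r b s : ℤ} (hu : (DnLabel.V a r).valid n)
    (hv : (DnLabel.V b s).valid n) (hab : a + 2 ≤ b ∨ b + 2 ≤ a) :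
    arrowWeight n (.V a r) (.V b s) = 0 := by
  rw [arrowWeight_V_V _ _ _ _ _ hu hv]
  have h1 : b ≠ a - 1 := by omega
  have h2 : b ≠ a + 1 := by omega
  have h3 : a ≠ b + 1 := by omega
  have h4 : a ≠ b := by omega
  simp [h1, h2, h3, h4]

lemma arrowWeight_V_up {i r s : ℤ} (hu : (DnLabel.V i r).valid n)
    (hv : (DnLabel.V (i + 1) s).valid n) :
    arrowWeight n (.V i r) (.V (i + 1) s) =
      if s = r ∧ 0 < r then 2
      else if r = -i ∧ s = -i - 1 then 1
      else if -i < r ∧ r ≤ 0 ∧ s = r - 1 then 2 else 0 := by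
  rw [arrowWeight_V_V _ _ _ _ _ hu hv]
  have h1 : i + 1 ≠ i - 1 := by omega
  have h2 : i ≠ i + 1 + 1 := by omega
  have h3 : i ≠ i + 1 := by omega
  simp only [h1, h2, h3, false_and, false_or, true_and, if_false]
  split_ifs <;> omega

lemma arrowWeight_V_down {i r s : ℤ} (hu : (DnLabel.V (i + 1) s).valid n)
    (hv : (DnLabel.V i r).valid n) :
    arrowWeight n (.V (i + 1) s) (.V i r) =
      if s = r ∧ r < 0 then 2
      else if r = i ∧ s = i + 1 then 1
      else if 0 ≤ r ∧ r < i ∧ s = r + 1 then 2 else 0 := by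
  rw [arrowWeight_V_V _ _ _ _ _ hu hv]
  have h1 : i = i + 1 - 1 := by omega
  have h2 : i ≠ i + 1 + 1 := by omega
  have h3 : i + 1 ≠ i := by omega
  simp only [← h1, h2, h3, false_and, or_false, true_and, if_false]
  split_ifs <;> omega

lemma eps2_V_same {i r s : ℤ} (hi : 1 ≤ i) (hin : i ≤ n) (hr : -i ≤ r) (hrs : r < s)
    (hs : s ≤ i) : eps2 n (.V i r) (.V i s) = if s = r + 1 then 2 else 0 := by
  have hu : (DnLabel.V i r).valid n := ⟨hi, hin, hr, by omega⟩
  have hv : (DnLabel.V i s).valid n := ⟨hi, hin, by omega, hs⟩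
  rw [eps2_eq_arrowWeight_sub, arrowWeight_V_same hu hv, arrowWeight_V_same hv hu,
    if_neg (show r ≠ s + 1 by omega), sub_zero]

lemma eps2_V_far {a r b s : ℤ} (ha : (DnLabel.V a r).valid n) (hb : (DnLabel.V b s).valid n)
    (hab : a + 2 ≤ b) : eps2 n (.V b s) (.V a r) = 0 := by
  rw [eps2_eq_arrowWeight_sub, arrowWeight_V_far hb ha (.inr hab),
    arrowWeight_V_far ha hb (.inl hab), sub_zero]

lemma eps2_V_adjacent {i r s : ℤ} (hi : 1 ≤ i) (hin : i + 1 ≤ n) (hr : -i ≤ r) (hri : r < i)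
    (hs : -(i + 1) ≤ s) (hsi : s ≤ i) :
    eps2 n (.V i r) (.V (i + 1) s) =
      if r = -i ∧ s = -i - 1 then 1
      else if r ≤ 0 ∧ s = r - 1 then 2
      else if r < 0 ∧ s = r then -2
      else if 0 < r ∧ s = r then 2
      else if 0 ≤ r ∧ s = r + 1 then -2 else 0 := by
  have hu : (DnLabel.V i r).valid n := ⟨hi, by omega, hr, by omega⟩
  have hv : (DnLabel.V (i + 1) s).valid n := ⟨by omega, hin, by omega, by omega⟩
  rw [eps2_eq_arrowWeight_sub, arrowWeight_V_up hu hv, arrowWeight_V_down hv hu]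
  split_ifs <;> omega

lemma qComm_Xg_Vprod_same {i r s : ℤ} (hi : 1 ≤ i) (hin : i ≤ n) (hr : -i - 1 ≤ r)
    (hrs : r < s) (hs : s ≤ i) :
    QComm qq (if s = r + 1 ∧ -i ≤ r then 2 else 0) (Xg n (.V i s)) (Vprod n i r) := by
  induction r, hr using Int.leInduction with
  | base =>
    rw [Vprod_neg_sub_one]
    exact QComm.one_right.congr (by split_ifs <;> omega)
  | succ r hr ih =>
    rw [Vprod_add_one n hr]
    refine ((ih (by omega)).mul_right qq_ne_zero
      (qComm_Xg_V ⟨hi, hin, by omega, hs⟩ ⟨hi, hin, by omega, by omega⟩)).congr ?_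
    rw [eps2_V_same hi hin (by omega) hrs hs]
    split_ifs <;> omega

lemma qComm_Vprod_same {i r s : ℤ} (hi : 1 ≤ i) (hin : i ≤ n) (hr : -i ≤ r)
    (hrs : r < s) (hs : s ≤ i) : QComm qq 2 (Vprod n i s) (Vprod n i r) := by
  induction s, (show r + 1 ≤ s by omega) using Int.leInduction with
  | base =>
    rw [Vprod_add_one n (by omega)]
    refine (QComm.self.mul_left qq_ne_zero
      (qComm_Xg_Vprod_same hi hin (by omega) (by omega) hs)).congr ?_
    split_ifs <;> omega
  | succ s hrs' ih =>
    rw [Vprod_add_one n (by omega)]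
    refine ((ih (by omega) (by omega)).mul_left qq_ne_zero
      (qComm_Xg_Vprod_same hi hin (by omega) (by omega) hs)).congr ?_
    split_ifs <;> omega

lemma qComm_Xg_Vprod_adjacent {i r s : ℤ} (hi : 1 ≤ i) (hin : i + 1 ≤ n) (hr : -i - 1 ≤ r)
    (hri : r < i) (hs : -(i + 1) ≤ s) (hsi : s ≤ i) :
    QComm qq (if s = -i - 1 then (if -i ≤ r then 1 else 0)
      else if (s < 0 ∧ r = s) ∨ (0 < s ∧ r = s - 1) then -2 else 0)
      (Xg n (.V (i + 1) s)) (Vprod n i r) := by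
  induction r, hr using Int.leInduction with
  | base =>
    rw [Vprod_neg_sub_one]
    exact QComm.one_right.congr (by split_ifs <;> omega)
  | succ r hr ih =>
    rw [Vprod_add_one n hr]
    refine ((ih (by omega)).mul_right qq_ne_zero
      (qComm_Xg_V ⟨by omega, hin, hs, by omega⟩ ⟨hi, by omega, by omega, by omega⟩)).congr ?_
    rw [eps2_V_adjacent hi hin (by omega) hri hs hsi]
    split_ifs <;> omega

lemma qComm_Vprod_adjacent {i r s : ℤ} (hi : 1 ≤ i) (hin : i + 1 ≤ n) (hr : -i ≤ r)
    (hri : r < i) (hs : -(i + 1) - 1 ≤ s) (hsi : s ≤ i) :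
    QComm qq (if s = -(i + 1) - 1 then 0 else if s < r ∨ (0 ≤ r ∧ s = r) then 1 else -1)
      (Vprod n (i + 1) s) (Vprod n i r) := by
  induction s, hs using Int.leInduction with
  | base =>
    rw [Vprod_neg_sub_one]
    exact QComm.one_left.congr (by split_ifs <;> omega)
  | succ s hs ih =>
    rw [Vprod_add_one n hs]
    refine ((ih (by omega)).mul_left qq_ne_zero
      (qComm_Xg_Vprod_adjacent hi hin (by omega) hri (by omega) hsi)).congr ?_
    split_ifs <;> omega

lemma qComm_Vprod_far {a b r s : ℤ} (ha : 1 ≤ a) (hab : a + 2 ≤ b) (hb : b ≤ n)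
    (hr : -a - 1 ≤ r) (hra : r ≤ a) (hs : -b - 1 ≤ s) (hsb : s ≤ b) :
    QComm qq 0 (Vprod n a r) (Vprod n b s) := by
  have hX : ∀ r, -a ≤ r → r ≤ a → QComm qq 0 (Xg n (.V a r)) (Vprod n b s) := by
    intro r hr hra
    induction s, hs using Int.leInduction with
    | base =>
      rw [Vprod_neg_sub_one]
      exact QComm.one_right
    | succ s hs ih =>
      have hA : 1 ≤ a ∧ a ≤ n ∧ -a ≤ r ∧ r ≤ a := ⟨ha, by omega, hr, hra⟩
      have hB : 1 ≤ b ∧ b ≤ n ∧ -b ≤ s + 1 ∧ s + 1 ≤ b := ⟨by omega, hb, by omega, hsb⟩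
      rw [Vprod_add_one n hs]
      exact ((ih (by omega)).mul_right qq_ne_zero (qComm_Xg_V hA hB)).congr
        (by rw [eps2_V_far hA hB hab, add_zero])
  induction r, hr using Int.leInduction with
  | base =>
    rw [Vprod_neg_sub_one]
    exact QComm.one_left
  | succ r hr ih =>
    rw [Vprod_add_one n hr]
    exact ((ih (by omega)).mul_left qq_ne_zero (hX (r + 1) (by omega) hra)).congr (add_zero 0)

lemma qComm_ww_same {i r s : ℤ} (hi : 1 ≤ i) (hin : i ≤ n) (hr : -i ≤ r)
    (hrs : r < s) (hs : s ≤ i) : QComm qq (-2) (ww n i r) (ww n i s) :=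
  (((qComm_Vprod_same hi hin hr hrs hs).symm qq_ne_zero).smul_left _).smul_right _

lemma qComm_ww_adjacent {i r s : ℤ} (hi : 1 ≤ i) (hin : i + 1 ≤ n) (hr : -i ≤ r)
    (hri : r < i) (hs : -(i + 1) ≤ s) (hsi : s ≤ i) :
    QComm qq (if s < r ∨ (0 ≤ r ∧ s = r) then 1 else -1) (ww n (i + 1) s) (ww n i r) :=
  (((qComm_Vprod_adjacent hi hin hr hri (by omega) hsi).congr
    (if_neg (by omega))).smul_left _).smul_right _

lemma qSerre_Ev_Ev_add_one {i : ℤ} (hi : 1 ≤ i) (hin : i + 1 ≤ n) :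
    QSerre qq (Ev n i) (Ev n (i + 1)) := by
  refine QSerre.sum_right fun s hs => ?_
  rw [Finset.mem_Icc] at hs
  refine QSerre.sum_left_of_initial qq_ne_zero _ _ _
    (fun r => ¬ (s < r ∨ (0 ≤ r ∧ s = r))) ?_ ?_ ?_ ?_
  · intros; omega
  · intro r hr t ht hrt
    rw [Finset.mem_Icc] at hr ht
    exact qComm_ww_same hi (by omega) hr.1 hrt (by omega)
  · intro r hr h
    rw [Finset.mem_Icc] at hr
    exact ((qComm_ww_adjacent hi hin hr.1 (by omega) hs.1 (by omega)).symm qq_ne_zero).congr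
      (by rw [if_neg h, neg_neg])
  · intro r hr h
    rw [Finset.mem_Icc] at hr
    exact ((qComm_ww_adjacent hi hin hr.1 (by omega) hs.1 (by omega)).symm qq_ne_zero).congr
      (by rw [if_pos (not_not.1 h)])

lemma qSerre_Ev_add_one_Ev {i : ℤ} (hi : 1 ≤ i) (hin : i + 1 ≤ n) :
    QSerre qq (Ev n (i + 1)) (Ev n i) := by
  refine QSerre.sum_right fun r hr => ?_
  rw [Finset.mem_Icc] at hr
  refine QSerre.sum_left_of_initial qq_ne_zero _ _ _
    (fun s => s < r ∨ (0 ≤ r ∧ s = r)) ?_ ?_ ?_ ?_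
  · intros; omega
  · intro s hs t ht hst
    rw [Finset.mem_Icc] at hs ht
    exact qComm_ww_same (by omega) hin hs.1 hst (by omega)
  · intro s hs h
    rw [Finset.mem_Icc] at hs
    exact (qComm_ww_adjacent hi hin hr.1 (by omega) hs.1 (by omega)).congr (if_pos h)
  · intro s hs h
    rw [Finset.mem_Icc] at hs
    exact (qComm_ww_adjacent hi hin hr.1 (by omega) hs.1 (by omega)).congr (if_neg h)

lemma commute_Ev_Ev {a b : ℤ} (ha : 1 ≤ a) (hab : a + 2 ≤ b) (hb : b ≤ n) :
    Commute (Ev n a) (Ev n b) := by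
  refine (QComm.sum_left (q := qq) fun r hr => QComm.sum_right fun s hs => ?_).commute
  rw [Finset.mem_Icc] at hr hs
  exact ((qComm_Vprod_far ha hab hb (by omega) (by omega) (by omega) (by omega)).smul_left
    _).smul_right _

lemma EEaux_succ (n : ℕ) (i : ℤ) (k : ℕ) :
    EEaux n i (k + 1) = qBracket qq (qq - qq⁻¹)⁻¹ (EEaux n i k) (Ev n (i + k + 1)) := rfl

lemma commute_EEaux_Ev_far {i l : ℤ} (hi : 1 ≤ i) (hl : l ≤ n) (k : ℕ) (hk : i + k + 2 ≤ l) :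
    Commute (EEaux n i k) (Ev n l) := by
  induction k with
  | zero => exact commute_Ev_Ev hi (by simpa using hk) hl
  | succ k ih =>
    rw [EEaux_succ]
    push_cast at hk
    exact ((QComm.of_commute (ih (by omega))).qBracket_of_commute _
      (commute_Ev_Ev (by omega) (by omega) hl)).commute

lemma qSerre_Ev_EEaux {i : ℤ} (hi : 1 ≤ i) (k : ℕ) (hk : i + k + 1 ≤ n) :
    QSerre qq (Ev n (i + k + 1)) (EEaux n i k) := by
  cases k with
  | zero =>
    simp only [Nat.cast_zero, add_zero] at hk ⊢
    exact qSerre_Ev_add_one_Ev hi hk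
  | succ k =>
    push_cast at hk ⊢
    rw [EEaux_succ]
    refine QSerre.qBracket_of_commute _ (commute_EEaux_Ev_far hi (by omega) k (by omega)) ?_
    rw [← add_assoc]
    exact qSerre_Ev_add_one_Ev (by omega) (by omega)

lemma qComm_EEaux_Ev_last {i : ℤ} (hi : 1 ≤ i) (k : ℕ) (hk : i + k + 1 ≤ n) :
    QComm qq (-1) (EEaux n i (k + 1)) (Ev n (i + k + 1)) :=
  qComm_qBracket_right_of_qSerre qq_ne_zero _ (qSerre_Ev_EEaux hi k hk)

lemma qComm_EEaux_Ev_first {i : ℤ} (hi : 1 ≤ i) (k : ℕ) (hk : i + k + 1 ≤ n) :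
    QComm qq 1 (EEaux n i (k + 1)) (Ev n i) := by
  induction k with
  | zero =>
    have h := qSerre_Ev_Ev_add_one hi (by simpa using hk)
    rw [EEaux_succ, Nat.cast_zero, add_zero]
    exact qComm_qBracket_left_of_qSerre qq_ne_zero _ h
  | succ k ih =>
    push_cast at hk
    rw [EEaux_succ]
    refine (ih (by omega)).qBracket_of_commute _ (commute_Ev_Ev hi ?_ ?_).symm <;>
      push_cast <;> omega

lemma commute_EEaux_Ev_middle {i : ℤ} (hi : 1 ≤ i) (m k : ℕ) (hmk : m + 2 ≤ k) (hk : i + k ≤ n) :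
    Commute (EEaux n i k) (Ev n (i + m + 1)) := by
  induction k, hmk using Nat.le_induction with
  | base =>
    push_cast at hk
    rw [EEaux_succ, EEaux_succ]
    refine commute_qBracket_qBracket qq_ne_zero one_add_qq_sq_ne_zero _ _
      (commute_EEaux_Ev_far hi ?_ m ?_) (qSerre_Ev_EEaux hi m (by omega)) ?_
    · push_cast; omega
    · push_cast; omega
    · push_cast
      rw [← add_assoc]
      exact qSerre_Ev_Ev_add_one (by omega) (by omega)
  | succ k hmk ih =>
    push_cast at hk
    rw [EEaux_succ]
    exact ((QComm.of_commute (ih (by omega))).qBracket_of_commute _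
      (commute_Ev_Ev (by omega) (by omega) (by omega)).symm).commute

end Torus

/-- For `1 ≤ i < j ≤ n` and `i ≤ k ≤ j` one has in `𝒟ₙ`:
`E_{i,j}E_k = q^{−1}E_kE_{i,j}` if `k = j`, `E_{i,j}E_k = qE_kE_{i,j}` if `k = i`, and
`E_{i,j}E_k = E_kE_{i,j}` if `i < k < j`. -/
theorem statement11 (n : ℕ) (hn : 1 ≤ n) (i j k : ℤ)
    (h1 : 1 ≤ i) (hij : i < j) (hj : j ≤ (n : ℤ)) (hik : i ≤ k) (hkj : k ≤ j) :
    (k = j → EE n i j * Ev n k = qq⁻¹ • (Ev n k * EE n i j)) ∧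
    (k = i → EE n i j * Ev n k = qq • (Ev n k * EE n i j)) ∧
    (i < k → k < j → EE n i j * Ev n k = Ev n k * EE n i j) := by
  obtain ⟨m, hm⟩ : ∃ m : ℕ, j = i + m + 1 := ⟨(j - i - 1).toNat, by omega⟩
  have hE : EE n i j = EEaux n i (m + 1) := by
    rw [EE, show (j - i).toNat = m + 1 by omega]
  rw [hE]
  refine ⟨fun h => ?_, fun h => ?_, fun h h' => ?_⟩
  · rw [h, hm]
    simpa only [QComm, zpow_neg_one] using qComm_EEaux_Ev_last h1 m (by omega)
  · rw [h]
    simpa only [QComm, zpow_one] using qComm_EEaux_Ev_first h1 m (by omega)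
  · obtain ⟨l, hl⟩ : ∃ l : ℕ, k = i + l + 1 := ⟨(k - i - 1).toNat, by omega⟩
    rw [hl]
    exact commute_EEaux_Ev_middle h1 l (m + 1) (by omega) (by push_cast; omega)

end
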